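/- Define T̃_{ψ,z}(a) := Σ_{s∈S} a_s F_{s,z} for a = {a_s}_{s∈S}, where F_{s,z} := ψ(z,s) h_{s,z}², h_{s,z} := T_{ψ,z}(e_s), and T_{ψ,z} is an interpolation operator of norm c for p = 2. Then T̃_{ψ,z} maps l_{1,ψ,z}(M') boundedly into H_{1,ψ}(M') with norm at most c², and (T̃_{ψ,z} a)(z,t) = a(z,t) for all t ∈ S; i.e. T̃_{ψ,z} is a bounded linear interpolation operator for p = 1. -/

import Mathlib

open Set
open scoped Manifold Topology ENNReal NNReal Classical

noncomputable section

/-- The weighted `ℓ^p` norm of `g` on the fibre `r ⁻¹' {x}` of a covering `r : N' → N`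
(the norm of the space `l_{p,ψ,x}`). -/
def fibLpNorm {N N' : Type*} (r : N' → N) (ψ : N' → ℝ) (p : ℝ≥0∞) (x : N)
    (g : N' → ℂ) : ℝ :=
  if p = ∞ then ⨆ y : r ⁻¹' {x}, ‖g ↑y‖ * ψ ↑y
  else (∑' y : r ⁻¹' {x}, ‖g ↑y‖ ^ p.toReal * ψ ↑y) ^ (1 / p.toReal)

/-- Membership in the space `l_{p,ψ,x}` of the fibre over `x`. -/
def MemFibLp {N N' : Type*} (r : N' → N) (ψ : N' → ℝ) (p : ℝ≥0∞) (x : N)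
    (g : N' → ℂ) : Prop :=
  if p = ∞ then BddAbove (range fun y : r ⁻¹' {x} => ‖g ↑y‖ * ψ ↑y)
  else Summable fun y : r ⁻¹' {x} => ‖g ↑y‖ ^ p.toReal * ψ ↑y

/-- The norm of the space `H_{p,ψ}(M')`: the sup over `x ∈ M` of the weighted `ℓ^p`
norms over the fibres `r ⁻¹' {x}`. -/
def covHpNorm {N N' : Type*} (r : N' → N) (ψ : N' → ℝ) (p : ℝ≥0∞) (M : Set N)
    (g : N' → ℂ) : ℝ :=
  ⨆ x : M, fibLpNorm r ψ p ↑x g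

/-- Membership in the space `H_{p,ψ}(M')` : `g` is holomorphic on `M' := r ⁻¹' M`,
its restriction to every fibre lies in `l_{p,ψ,x}`, and its `H_{p,ψ}` norm is finite. -/
def MemCovHp (H : Type*) [NormedAddCommGroup H] [NormedSpace ℂ H]
    {N N' : Type*} [TopologicalSpace N] [ChartedSpace H N]
    [TopologicalSpace N'] [ChartedSpace H N']
    (r : N' → N) (ψ : N' → ℝ) (p : ℝ≥0∞) (M : Set N) (g : N' → ℂ) : Prop :=
  MDifferentiableOn 𝓘(ℂ, H) 𝓘(ℂ, ℂ) g (r ⁻¹' M) ∧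
  (∀ x ∈ M, MemFibLp r ψ p x g) ∧
  BddAbove (range fun x : M => fibLpNorm r ψ p ↑x g)

/-- A relatively compact domain `M ⊂⊂ N` with smooth boundary which is strongly
pseudoconvex: `M = {ρ < 0}` for a `C²` function `ρ` defined near `closure M` with
`dρ ≠ 0` on the boundary, whose Levi form is positive on the complex tangent space
of the boundary.  (In a chart, the Levi form applied to `w` equals
`(1/4)(Hess ρ (w,w) + Hess ρ (i•w, i•w))`, and the complex tangency of `w` means
`dρ(w) = dρ(i•w) = 0`.) -/
def IsStronglyPseudoconvexDomain (H : Type*) [NormedAddCommGroup H] [NormedSpace ℂ H]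
    {N : Type*} [TopologicalSpace N] [ChartedSpace H N] (M : Set N) : Prop :=
  IsOpen M ∧ IsConnected M ∧ IsCompact (closure M) ∧
  ∃ (Ω : Set N) (ρ : N → ℝ), IsOpen Ω ∧ closure M ⊆ Ω ∧
    M = {z ∈ Ω | ρ z < 0} ∧
    (∀ z ∈ Ω, ContDiffAt ℝ 2 (fun u => ρ ((chartAt H z).symm u)) (chartAt H z z)) ∧
    (∀ z ∈ frontier M, fderiv ℝ (fun u => ρ ((chartAt H z).symm u)) (chartAt H z z) ≠ 0) ∧
    (∀ z ∈ frontier M, ∀ w : H, w ≠ 0 →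
      fderiv ℝ (fun u => ρ ((chartAt H z).symm u)) (chartAt H z z) w = 0 →
      fderiv ℝ (fun u => ρ ((chartAt H z).symm u)) (chartAt H z z) ((Complex.I : ℂ) • w) = 0 →
      0 < fderiv ℝ (fun u => fderiv ℝ (fun v => ρ ((chartAt H z).symm v)) u w)
            (chartAt H z z) w +
          fderiv ℝ (fun u => fderiv ℝ (fun v => ρ ((chartAt H z).symm v)) u
            ((Complex.I : ℂ) • w)) (chartAt H z z) ((Complex.I : ℂ) • w))

/-- An open subset which is a Stein manifold: it is holomorphically separable and
holomorphically convex (every compact subset has compact holomorphically convex hull). -/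
def IsSteinOpen (H : Type*) [NormedAddCommGroup H] [NormedSpace ℂ H]
    {N : Type*} [TopologicalSpace N] [ChartedSpace H N] (Ω : Set N) : Prop :=
  IsOpen Ω ∧
  (∀ x ∈ Ω, ∀ y ∈ Ω, x ≠ y →
    ∃ f : N → ℂ, MDifferentiableOn 𝓘(ℂ, H) 𝓘(ℂ, ℂ) f Ω ∧ f x ≠ f y) ∧
  (∀ K : Set N, K ⊆ Ω → IsCompact K →
    IsCompact {x ∈ Ω | ∀ f : N → ℂ, MDifferentiableOn 𝓘(ℂ, H) 𝓘(ℂ, ℂ) f Ω →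
      ‖f x‖ ≤ ⨆ y : K, ‖f ↑y‖})

/-- A holomorphically convex open subset: the holomorphically convex hull (with respect
to functions holomorphic on `V`) of every compact subset of `V` is compact. -/
def IsHolomorphicallyConvexOpen (H : Type*) [NormedAddCommGroup H] [NormedSpace ℂ H]
    {N : Type*} [TopologicalSpace N] [ChartedSpace H N] (V : Set N) : Prop :=
  IsOpen V ∧
  (∀ K : Set N, K ⊆ V → IsCompact K →
    IsCompact {x ∈ V | ∀ f : N → ℂ, MDifferentiableOn 𝓘(ℂ, H) 𝓘(ℂ, ℂ) f V →
      ‖f x‖ ≤ ⨆ y : K, ‖f ↑y‖})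

/-- A compact subset which is holomorphically convex in `M`: it coincides with its
holomorphically convex hull with respect to functions holomorphic on `M`. -/
def IsHolConvexCompactIn (H : Type*) [NormedAddCommGroup H] [NormedSpace ℂ H]
    {N : Type*} [TopologicalSpace N] [ChartedSpace H N] (M K : Set N) : Prop :=
  IsCompact K ∧ K ⊆ M ∧
  {x ∈ M | ∀ f : N → ℂ, MDifferentiableOn 𝓘(ℂ, H) 𝓘(ℂ, ℂ) f M →
    ‖f x‖ ≤ ⨆ y : K, ‖f ↑y‖} ⊆ K

/-- A compact complex subvariety of `M` of complex dimension `≥ 1`: a nonempty compact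
subset of `M`, without isolated points (which for analytic sets is equivalent to having
positive dimension at each point), which is locally the common zero set of a family of
holomorphic functions. -/
def IsCompactPosDimSubvariety (H : Type*) [NormedAddCommGroup H] [NormedSpace ℂ H]
    {N : Type*} [TopologicalSpace N] [ChartedSpace H N] (M A : Set N) : Prop :=
  A.Nonempty ∧ A ⊆ M ∧ IsCompact A ∧
  (∀ x ∈ A, x ∈ closure (A \ {x})) ∧
  (∀ x ∈ A, ∃ U : Set N, IsOpen U ∧ x ∈ U ∧
    ∃ F : Set (N → ℂ), (∀ f ∈ F, MDifferentiableOn 𝓘(ℂ, H) 𝓘(ℂ, ℂ) f U) ∧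
      A ∩ U = {y ∈ U | ∀ f ∈ F, f y = 0})

/-- `C_M`: the union of all compact complex subvarieties of `M` of complex
dimension `≥ 1`. -/
def varietyUnion (H : Type*) [NormedAddCommGroup H] [NormedSpace ℂ H]
    {N : Type*} [TopologicalSpace N] [ChartedSpace H N] (M : Set N) : Set N :=
  ⋃₀ {A : Set N | IsCompactPosDimSubvariety H M A}

/-- The inclusion `M ↪ N` induces an isomorphism of fundamental groups
(`π₁(M) = π₁(N)`): every loop in `N` based at a point of `M` is homotopic to a loop in
`M`, and loops in `M` which are homotopic in `N` are homotopic in `M`. -/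
def InducesPi1Iso {N : Type*} [TopologicalSpace N] (M : Set N) : Prop :=
  ∀ x₀ : M,
    (∀ γ : Path (x₀ : N) (x₀ : N),
      ∃ δ : Path x₀ x₀, Path.Homotopic γ (δ.map continuous_subtype_val)) ∧
    (∀ δ δ' : Path x₀ x₀,
      Path.Homotopic (δ.map continuous_subtype_val) (δ'.map continuous_subtype_val) →
      Path.Homotopic δ δ')

/-- A closed complex submanifold `Y` of an open set `V`: `Y ⊆ V` is closed in `V` and
is locally the zero set of a holomorphic submersion into some `ℂ^k`. -/
def IsClosedComplexSubmanifoldIn (H : Type*) [NormedAddCommGroup H] [NormedSpace ℂ H]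
    {N : Type*} [TopologicalSpace N] [ChartedSpace H N] (V Y : Set N) : Prop :=
  Y ⊆ V ∧ closure Y ∩ V ⊆ Y ∧
  ∀ y ∈ Y, ∃ (k : ℕ) (U : Set N) (f : N → (Fin k → ℂ)),
    IsOpen U ∧ y ∈ U ∧ U ⊆ V ∧
    MDifferentiableOn 𝓘(ℂ, H) 𝓘(ℂ, Fin k → ℂ) f U ∧
    Y ∩ U = {x ∈ U | f x = 0} ∧
    ∀ x ∈ Y ∩ U, Function.Surjective (mfderiv 𝓘(ℂ, H) 𝓘(ℂ, Fin k → ℂ) f x)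

open Filter

/-- Complex differentiability of a scalar function on a manifold, read in the preferred chart. -/
theorem mdifferentiableAt_complex_iff {E X : Type*} [NormedAddCommGroup E] [NormedSpace ℂ E]
    [TopologicalSpace X] [ChartedSpace E X] {g : X → ℂ} {w : X} :
    MDifferentiableAt 𝓘(ℂ, E) 𝓘(ℂ, ℂ) g w ↔
      DifferentiableAt ℂ (fun u => g ((chartAt E w).symm u)) (chartAt E w w) := by
  have hiff : MDifferentiableAt 𝓘(ℂ, E) 𝓘(ℂ, ℂ) g w ↔ ContinuousAt g w ∧
      DifferentiableAt ℂ (fun u => g ((chartAt E w).symm u)) (chartAt E w w) := by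
    rw [mdifferentiableAt_iff]
    simp only [writtenInExtChartAt, Function.comp_def, differentiableWithinAt_univ, mfld_simps]
    rfl
  refine hiff.trans (and_iff_right_of_imp fun h => ?_)
  have hw := mem_chart_source E w
  have hcomp : ContinuousAt (fun y => g ((chartAt E w).symm (chartAt E w y))) w :=
    h.continuousAt.comp ((chartAt E w).continuousAt hw)
  refine hcomp.congr ?_
  filter_upwards [(chartAt E w).open_source.mem_nhds hw] with y hy
  rw [(chartAt E w).left_inv hy]

/-- A pointwise sum of functions differentiable at `p`, whose difference quotients at `p` are
dominated by a summable sequence, is differentiable at `p`. -/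
theorem differentiableAt_tsum_of_summable_lipschitz_at {ι 𝕜 E G : Type*}
    [NontriviallyNormedField 𝕜] [NormedAddCommGroup E] [NormedSpace 𝕜 E]
    [NormedAddCommGroup G] [NormedSpace 𝕜 G] [CompleteSpace G]
    {g : ι → E → G} {p : E} {B : ι → ℝ} (hB0 : ∀ s, 0 ≤ B s) (hB : Summable B)
    (hg : ∀ s, DifferentiableAt 𝕜 (g s) p) (hgp : Summable fun s => g s p)
    (hlip : ∀ᶠ u in 𝓝 p, ∀ s, ‖g s u - g s p‖ ≤ B s * ‖u - p‖) :
    DifferentiableAt 𝕜 (fun u => ∑' s, g s u) p := by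
  have hL : ∀ s, ‖fderiv 𝕜 (g s) p‖ ≤ B s := fun s =>
    (hg s).hasFDerivAt.le_of_lip' (hB0 s) (hlip.mono fun u hu => hu s)
  have hLs : Summable fun s => fderiv 𝕜 (g s) p := Summable.of_norm_bounded hB hL
  refine HasFDerivAt.differentiableAt (f' := ∑' s, fderiv 𝕜 (g s) p) ?_
  rw [hasFDerivAt_iff_tendsto]
  have key : Tendsto (fun u => ∑' s, ‖u - p‖⁻¹ * ‖g s u - g s p - fderiv 𝕜 (g s) p (u - p)‖)
      (𝓝 p) (𝓝 (∑' _ : ι, (0 : ℝ))) := by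
    refine tendsto_tsum_of_dominated_convergence (bound := fun s => 2 * B s) (hB.mul_left 2)
      (fun s => hasFDerivAt_iff_tendsto.1 (hg s).hasFDerivAt) ?_
    filter_upwards [hlip] with u hu s
    rw [Real.norm_of_nonneg (by positivity)]
    have h1 : ‖g s u - g s p - fderiv 𝕜 (g s) p (u - p)‖ ≤ 2 * B s * ‖u - p‖ := by
      refine (norm_sub_le _ _).trans ?_
      have := (fderiv 𝕜 (g s) p).le_of_opNorm_le (hL s) (u - p)
      linarith [hu s]
    rcases (norm_nonneg (u - p)).eq_or_lt with h0 | h0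
    · rw [← h0]
      simpa using hB0 s
    · rw [inv_mul_le_iff₀ h0]
      linarith
  rw [tsum_zero] at key
  refine squeeze_zero' (Eventually.of_forall fun u => by positivity) ?_ key
  filter_upwards [hlip] with u hu
  have hd : Summable fun s => g s u - g s p := Summable.of_norm_bounded (hB.mul_right _) hu
  have hgu : Summable fun s => g s u := by simpa using hd.add hgp
  have hLu : Summable fun s => fderiv 𝕜 (g s) p (u - p) :=
    (ContinuousLinearMap.apply 𝕜 G (u - p)).summable hLs
  have hLe : (∑' s, fderiv 𝕜 (g s) p) (u - p) = ∑' s, fderiv 𝕜 (g s) p (u - p) :=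
    (ContinuousLinearMap.apply 𝕜 G (u - p)).map_tsum hLs
  have hns : Summable fun s => ‖g s u - g s p - fderiv 𝕜 (g s) p (u - p)‖ := by
    refine Summable.of_nonneg_of_le (fun _ => norm_nonneg _) (fun s => norm_sub_le _ _)
      (Summable.add (Summable.of_nonneg_of_le (fun _ => norm_nonneg _) hu (hB.mul_right _))
        (Summable.of_nonneg_of_le (fun _ => norm_nonneg _)
          (fun s => (fderiv 𝕜 (g s) p).le_of_opNorm_le (hL s) (u - p)) (hB.mul_right _)))
  rw [hLe, ← hgu.tsum_sub hgp, ← hd.tsum_sub hLu, tsum_mul_left]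
  gcongr
  exact norm_tsum_le_tsum_norm hns

/-- A locally bounded family of functionals which is pointwise differentiable at `p`
is norm-Lipschitz at `p`. -/
theorem exists_lipschitz_at_of_pointwise_differentiableAt {E X : Type*}
    [NormedAddCommGroup E] [NormedSpace ℂ E]
    [NormedAddCommGroup X] [NormedSpace ℂ X] [CompleteSpace X]
    {Φ : E → X →L[ℂ] ℂ} {p : E} {K : ℝ}
    (hd : ∀ x, DifferentiableAt ℂ (fun u => Φ u x) p) (hK : ∀ᶠ u in 𝓝 p, ‖Φ u‖ ≤ K) :
    ∃ C : ℝ, ∀ᶠ u in 𝓝 p, ‖Φ u - Φ p‖ ≤ C * ‖u - p‖ := by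
  have hKp : ‖Φ p‖ ≤ K := hK.self_of_nhds
  obtain ⟨C, hC⟩ := banach_steinhaus
    (g := fun u : {u // ‖Φ u‖ ≤ K} => ((‖(u : E) - p‖⁻¹ : ℝ) : ℂ) • (Φ u - Φ p)) (by
      intro x
      obtain ⟨D, hD⟩ := (hd x).hasFDerivAt.isBigO_sub.bound
      obtain ⟨δ, hδ, hball⟩ := Metric.eventually_nhds_iff.1 hD
      refine ⟨max D (δ⁻¹ * (2 * K * ‖x‖)), fun u => ?_⟩
      have hn : ‖(((‖(u : E) - p‖⁻¹ : ℝ) : ℂ) • (Φ u - Φ p)) x‖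
          = ‖(u : E) - p‖⁻¹ * ‖Φ u x - Φ p x‖ := by
        simp
      rw [hn]
      by_cases hu : dist (u : E) p < δ
      · have hb := hball hu
        rcases (norm_nonneg ((u : E) - p)).eq_or_lt with h0 | h0
        · have : (u : E) = p := by simpa [sub_eq_zero] using h0.symm
          rw [this]
          have : 0 ≤ δ⁻¹ * (2 * K * ‖x‖) := by
            have := (norm_nonneg _).trans hKp
            positivity
          simpa using Or.inr this
        · refine le_max_of_le_left ?_
          rw [inv_mul_le_iff₀ h0]
          linarith
      · refine le_max_of_le_right ?_
        rw [not_lt, dist_eq_norm] at hu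
        have h1 := (Φ u).le_of_opNorm_le u.2 x
        have h2 := (Φ p).le_of_opNorm_le hKp x
        have h3 : ‖Φ u x - Φ p x‖ ≤ 2 * K * ‖x‖ := (norm_sub_le _ _).trans (by linarith)
        gcongr)
  refine ⟨C, hK.mono fun u hu => ?_⟩
  have h := hC ⟨u, hu⟩
  rcases (norm_nonneg (u - p)).eq_or_lt with h0 | h0
  · have : u = p := by simpa [sub_eq_zero] using h0.symm
    simp [this]
  · rw [norm_smul, Complex.norm_real, norm_inv, norm_norm, inv_mul_le_iff₀ h0] at h
    linarith

/-- Minkowski's inequality for weighted `ℓ¹` norms of a series of functions. -/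
theorem summable_norm_tsum_mul_and_tsum_le {ι κ : Type*} {G : ι → κ → ℂ} {φ : κ → ℝ}
    {b : ι → ℝ} (hφ : ∀ y, 0 ≤ φ y) (hb : Summable b)
    (hG : ∀ s, Summable fun y => ‖G s y‖ * φ y)
    (hGb : ∀ s, ∑' y, ‖G s y‖ * φ y ≤ b s)
    (hGs : ∀ y, Summable fun s => ‖G s y‖) :
    (Summable fun y => ‖∑' s, G s y‖ * φ y) ∧
      ∑' y, ‖∑' s, G s y‖ * φ y ≤ ∑' s, b s := by
  have hnn : ∀ s y, 0 ≤ ‖G s y‖ * φ y := fun s y => mul_nonneg (norm_nonneg _) (hφ y)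
  have hS : Summable fun s => ∑' y, ‖G s y‖ * φ y :=
    Summable.of_nonneg_of_le (fun s => tsum_nonneg (hnn s)) hGb hb
  have hP : Summable (Function.uncurry fun s y => ‖G s y‖ * φ y) :=
    (summable_prod_of_nonneg fun q => hnn q.1 q.2).2 ⟨hG, hS⟩
  have hQ : Summable fun y => ∑' s, ‖G s y‖ * φ y :=
    ((Equiv.prodComm κ ι).summable_iff.2 hP).prod
  have hle : ∀ y, ‖∑' s, G s y‖ * φ y ≤ ∑' s, ‖G s y‖ * φ y := fun y => by
    rw [tsum_mul_right]
    exact mul_le_mul_of_nonneg_right (norm_tsum_le_tsum_norm (hGs y)) (hφ y)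
  have hR := Summable.of_nonneg_of_le (fun y => mul_nonneg (norm_nonneg _) (hφ y)) hle hQ
  refine ⟨hR, (hR.tsum_le_tsum hle hQ).trans ?_⟩
  rw [hP.tsum_comm]
  exact hS.tsum_le_tsum hGb hb

section FibreSpaces

variable {N N' : Type*} {r : N' → N} {ψ : N' → ℝ} {x : N} {g : N' → ℂ}

theorem memFibLp_one_iff :
    MemFibLp r ψ 1 x g ↔ Summable fun y : r ⁻¹' {x} => ‖g y‖ * ψ y := by
  simp [MemFibLp]

theorem fibLpNorm_one : fibLpNorm r ψ 1 x g = ∑' y : r ⁻¹' {x}, ‖g y‖ * ψ y := by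
  simp [fibLpNorm]

theorem memFibLp_two_iff :
    MemFibLp r ψ 2 x g ↔ Summable fun y : r ⁻¹' {x} => ‖g y‖ ^ 2 * ψ y := by
  simp [MemFibLp]

theorem fibLpNorm_two :
    fibLpNorm r ψ 2 x g = √(∑' y : r ⁻¹' {x}, ‖g y‖ ^ 2 * ψ y) := by
  simp [fibLpNorm, Real.sqrt_eq_rpow]

theorem rpow_neg_half_sq_mul {t : ℝ} (ht : 0 < t) : (t ^ (-(1 / 2) : ℝ)) ^ 2 * t = 1 := by
  rw [← Real.rpow_natCast, ← Real.rpow_mul ht.le]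
  norm_num
  rw [Real.rpow_neg_one, inv_mul_cancel₀ ht.ne']

/-- The function on `N'` supported on the fibre over `x` whose coordinates in the
orthonormal basis of the weighted `ℓ²` space of that fibre are `ξ`. -/
def fibExtend (r : N' → N) (ψ : N' → ℝ) (x : N) (ξ : r ⁻¹' {x} → ℂ) (y : N') : ℂ :=
  if h : y ∈ r ⁻¹' {x} then ξ ⟨y, h⟩ * ((ψ y ^ (-(1 / 2) : ℝ) : ℝ) : ℂ) else 0

theorem fibExtend_add (ξ η : r ⁻¹' {x} → ℂ) :
    fibExtend r ψ x (ξ + η) = fibExtend r ψ x ξ + fibExtend r ψ x η := by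
  ext y
  by_cases h : y ∈ r ⁻¹' {x}
  · simp only [fibExtend, h, dite_true, Pi.add_apply, add_mul]
  · simp only [fibExtend, h, dite_false, Pi.add_apply, add_zero]

theorem fibExtend_smul (a : ℂ) (ξ : r ⁻¹' {x} → ℂ) :
    fibExtend r ψ x (a • ξ) = a • fibExtend r ψ x ξ := by
  ext y
  by_cases h : y ∈ r ⁻¹' {x}
  · simp only [fibExtend, h, dite_true, Pi.smul_apply, smul_eq_mul, mul_assoc]
  · simp only [fibExtend, h, dite_false, Pi.smul_apply, smul_zero]

theorem fibExtend_single (s : r ⁻¹' {x}) :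
    fibExtend r ψ x (lp.single (E := fun _ : r ⁻¹' {x} => ℂ) 2 s (1 : ℂ)) =
      fun y => if y = ↑s then ((ψ s ^ (-(1 / 2) : ℝ) : ℝ) : ℂ) else 0 := by
  ext y
  by_cases hy : y = s
  · subst hy
    have h : (s : N') ∈ r ⁻¹' {x} := s.2
    simp only [fibExtend, h, dite_true, if_true, lp.single_apply_self, one_mul]
  · by_cases h : y ∈ r ⁻¹' {x}
    · have : (⟨y, h⟩ : r ⁻¹' {x}) ≠ s := fun e => hy (congrArg Subtype.val e)
      simp only [fibExtend, h, dite_true, hy, if_false, lp.single_apply_ne _ _ _ this, zero_mul]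
    · simp only [fibExtend, h, dite_false, hy, if_false]

theorem norm_fibExtend_sq_mul (hψ : ∀ y, 0 < ψ y) (ξ : r ⁻¹' {x} → ℂ) (y : r ⁻¹' {x}) :
    ‖fibExtend r ψ x ξ y‖ ^ 2 * ψ y = ‖ξ y‖ ^ 2 := by
  have h : (y : N') ∈ r ⁻¹' {x} := y.2
  simp only [fibExtend, h, dite_true, Subtype.coe_eta, norm_mul, Complex.norm_real, mul_pow,
    Real.norm_eq_abs, sq_abs, mul_assoc, rpow_neg_half_sq_mul (hψ y), mul_one]

theorem memFibLp_fibExtend (hψ : ∀ y, 0 < ψ y) (ξ : lp (fun _ : r ⁻¹' {x} => ℂ) 2) :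
    MemFibLp r ψ 2 x (fibExtend r ψ x ξ) := by
  rw [memFibLp_two_iff]
  simp only [norm_fibExtend_sq_mul hψ]
  simpa using (lp.memℓp ξ).summable (by norm_num)

theorem fibLpNorm_fibExtend (hψ : ∀ y, 0 < ψ y) (ξ : lp (fun _ : r ⁻¹' {x} => ℂ) 2) :
    fibLpNorm r ψ 2 x (fibExtend r ψ x ξ) = ‖ξ‖ := by
  rw [fibLpNorm_two, lp.norm_eq_tsum_rpow (by norm_num)]
  simp only [norm_fibExtend_sq_mul hψ]
  simp [Real.sqrt_eq_rpow]

theorem norm_sq_mul_le_tsum (hψ : ∀ y, 0 < ψ y) {w : N'}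
    (hg : Summable fun y : r ⁻¹' {r w} => ‖g y‖ ^ 2 * ψ y) :
    ‖g w‖ ^ 2 * ψ w ≤ ∑' y : r ⁻¹' {r w}, ‖g y‖ ^ 2 * ψ y :=
  hg.le_tsum (⟨w, rfl⟩ : r ⁻¹' {r w})
    fun y _ => mul_nonneg (sq_nonneg _) (hψ y).le

/-- A bound on the `H_{2,ψ}` norm bounds the weighted square sums over all fibres. -/
theorem MemCovHp.tsum_sq_le {H : Type*} [NormedAddCommGroup H] [NormedSpace ℂ H]
    [TopologicalSpace N] [ChartedSpace H N] [TopologicalSpace N'] [ChartedSpace H N']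
    {M : Set N} (hg : MemCovHp H r ψ 2 M g) {C : ℝ}
    (hC : covHpNorm r ψ 2 M g ≤ C) (hx : x ∈ M) :
    ∑' y : r ⁻¹' {x}, ‖g y‖ ^ 2 * ψ y ≤ C ^ 2 := by
  have h : fibLpNorm r ψ 2 x g ≤ C := (le_ciSup hg.2.2 ⟨x, hx⟩).trans hC
  rw [fibLpNorm_two, Real.sqrt_le_iff] at h
  exact h.2

end FibreSpaces

/-- Evaluation at a point of `M'`, composed with a bounded operator from the weighted `ℓ²`
space of a fibre to `H_{2,ψ}(M')`, is a bounded functional. -/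
theorem exists_evaluation_functional {H N N' : Type*} [NormedAddCommGroup H] [NormedSpace ℂ H]
    [TopologicalSpace N] [ChartedSpace H N] [TopologicalSpace N'] [ChartedSpace H N']
    {r : N' → N} {ψ : N' → ℝ} {M : Set N} {z : N} (hψ : ∀ y, 0 < ψ y)
    {T : (N' → ℂ) → (N' → ℂ)} {c : ℝ} (hc : 0 ≤ c)
    (hTadd : ∀ h₁ h₂ : N' → ℂ, T (h₁ + h₂) = T h₁ + T h₂)
    (hTsmul : ∀ (a : ℂ) (h : N' → ℂ), T (a • h) = a • T h)
    (hTmem : ∀ h : N' → ℂ, MemFibLp r ψ 2 z h → MemCovHp H r ψ 2 M (T h))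
    (hTle : ∀ h : N' → ℂ, MemFibLp r ψ 2 z h →
      covHpNorm r ψ 2 M (T h) ≤ c * fibLpNorm r ψ 2 z h)
    {w : N'} (hw : r w ∈ M) :
    ∃ Φ : lp (fun _ : r ⁻¹' {z} => ℂ) 2 →L[ℂ] ℂ,
      (∀ ξ, Φ ξ = T (fibExtend r ψ z ξ) w) ∧ ‖Φ‖ ≤ c * (√(ψ w))⁻¹ := by
  have hbound : ∀ ξ : lp (fun _ : r ⁻¹' {z} => ℂ) 2,
      ‖T (fibExtend r ψ z ξ) w‖ ≤ c * (√(ψ w))⁻¹ * ‖ξ‖ := by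
    intro ξ
    have hm := memFibLp_fibExtend hψ ξ
    have h1 := (norm_sq_mul_le_tsum hψ (memFibLp_two_iff.1 ((hTmem _ hm).2.1 _ hw))).trans
      ((hTmem _ hm).tsum_sq_le (hTle _ hm) hw)
    rw [fibLpNorm_fibExtend hψ] at h1
    have hs : 0 < √(ψ w) := Real.sqrt_pos.2 (hψ w)
    have h2 : ‖T (fibExtend r ψ z ξ) w‖ * √(ψ w) ≤ c * ‖ξ‖ := by
      refine le_of_sq_le_sq ?_ (by positivity)
      rwa [mul_pow, Real.sq_sqrt (hψ w).le]
    rw [mul_right_comm, ← div_eq_mul_inv, le_div_iff₀ hs]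
    exact h2
  refine ⟨LinearMap.mkContinuous
    { toFun := fun ξ => T (fibExtend r ψ z ξ) w
      map_add' := fun ξ η => by
        rw [lp.coeFn_add, fibExtend_add, hTadd, Pi.add_apply]
      map_smul' := fun a ξ => by
        rw [lp.coeFn_smul, fibExtend_smul, hTsmul, Pi.smul_apply, RingHom.id_apply] }
    (c * (√(ψ w))⁻¹) hbound, fun ξ => rfl, LinearMap.mkContinuous_norm_le _ (by positivity) _⟩

/-- **The operator (2.4) for `p = 1`.** Fix `z ∈ M \ C_M`, let `{e_s}` be the
orthonormal basis of `l_{2,ψ,z}(M')`, `h_{s,z} := T_{ψ,z}(e_s)` for a bounded linear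
interpolation operator `T_{ψ,z}` of norm `c` for `p = 2`, `F_{s,z} := ψ(s)·h_{s,z}²`,
and define `T̃_{ψ,z}(a) := Σ_s a_s F_{s,z}`.  Then `T̃_{ψ,z}` maps `l_{1,ψ,z}(M')`
boundedly into `H_{1,ψ}(M')` with norm at most `c²` and `(T̃_{ψ,z} a)(x) = a(x)` on
the fibre over `z`; i.e. it is a bounded linear interpolation operator for `p = 1`. -/
theorem tilde_operator_interpolates_p_one
    (n : ℕ)
    {N : Type*} [TopologicalSpace N] [ChartedSpace (Fin n → ℂ) N]
    {N' : Type*} [MetricSpace N'] [ChartedSpace (Fin n → ℂ) N']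
    (r : N' → N) (hr : IsCoveringMap r)
    (hrholo : MDifferentiable 𝓘(ℂ, Fin n → ℂ) 𝓘(ℂ, Fin n → ℂ) r)
    (M : Set N) (hM : IsStronglyPseudoconvexDomain (Fin n → ℂ) M)
    (ψ : N' → ℝ) (hψpos : ∀ y, 0 < ψ y)
    (hψuc : UniformContinuous fun y => Real.log (ψ y))
    (z : N) (hz : z ∈ M \ varietyUnion (Fin n → ℂ) M)
    -- `T` is a bounded linear interpolation operator of norm `c` for `p = 2`
    (T : (N' → ℂ) → (N' → ℂ)) (c : ℝ) (hc : 0 ≤ c)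
    (hTadd : ∀ h₁ h₂ : N' → ℂ, T (h₁ + h₂) = T h₁ + T h₂)
    (hTsmul : ∀ (a : ℂ) (h : N' → ℂ), T (a • h) = a • T h)
    (hT : ∀ h : N' → ℂ, MemFibLp r ψ 2 z h →
      MemCovHp (Fin n → ℂ) r ψ 2 M (T h) ∧
      covHpNorm r ψ 2 M (T h) ≤ c * fibLpNorm r ψ 2 z h ∧
      ∀ x ∈ r ⁻¹' {z}, T h x = h x)
    -- `F_{s,z}(w) = ψ(z,s) h_{s,z}(w)²` where `h_{s,z} = T(e_s)`
    (F : r ⁻¹' {z} → N' → ℂ)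
    (hF : ∀ (s : r ⁻¹' {z}) (w : N'),
      F s w = (ψ ↑s : ℂ) *
        (T (fun y => if y = ↑s then (((ψ ↑s) ^ (-(1/2) : ℝ) : ℝ) : ℂ) else 0) w) ^ 2)
    -- `T̃(a) = Σ_s a_s F_{s,z}`
    (Tt : (N' → ℂ) → (N' → ℂ))
    (hTt : ∀ (a : N' → ℂ) (w : N'), Tt a w = ∑' s : r ⁻¹' {z}, a ↑s * F s w) :
    ∀ a : N' → ℂ, MemFibLp r ψ 1 z a →
      MemCovHp (Fin n → ℂ) r ψ 1 M (Tt a) ∧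
      covHpNorm r ψ 1 M (Tt a) ≤ c ^ 2 * fibLpNorm r ψ 1 z a ∧
      ∀ x ∈ r ⁻¹' {z}, Tt a x = a x := by
  have hMo : IsOpen M := hM.1
  have hM'o : IsOpen (r ⁻¹' M) := hMo.preimage hr.continuous
  have hψc : Continuous ψ :=
    (Real.continuous_exp.comp hψuc.continuous).congr fun y => Real.exp_log (hψpos y)
  have : Nonempty M := ⟨⟨z, hz.1⟩⟩
  let e : r ⁻¹' {z} → lp (fun _ : r ⁻¹' {z} => ℂ) 2 := fun s => lp.single 2 s (1 : ℂ)
  have hen : ∀ s, ‖e s‖ = 1 := fun s => by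
    simp [e, lp.norm_single]
  have hFe : ∀ s w, F s w = (ψ ↑s : ℂ) * (T (fibExtend r ψ z (e s)) w) ^ 2 := fun s w => by
    rw [hF, fibExtend_single]
  have hTm := fun ξ => hT _ (memFibLp_fibExtend hψpos ξ)
  have hsum : ∀ s, ∀ x ∈ M,
      Summable (fun y : r ⁻¹' {x} => ‖T (fibExtend r ψ z (e s)) y‖ ^ 2 * ψ y) ∧
      ∑' y : r ⁻¹' {x}, ‖T (fibExtend r ψ z (e s)) y‖ ^ 2 * ψ y ≤ c ^ 2 := fun s x hx => by
    refine ⟨memFibLp_two_iff.1 ((hTm _).1.2.1 x hx), (hTm _).1.tsum_sq_le ?_ hx⟩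
    simpa [fibLpNorm_fibExtend hψpos, hen] using (hTm (e s)).2.1
  have hΦ : ∀ w, ∃ Φ : lp (fun _ : r ⁻¹' {z} => ℂ) 2 →L[ℂ] ℂ, r w ∈ M →
      (∀ ξ, Φ ξ = T (fibExtend r ψ z ξ) w) ∧ ‖Φ‖ ≤ c * (√(ψ w))⁻¹ := fun w => by
    by_cases hw : r w ∈ M
    · obtain ⟨Φ, h⟩ := exists_evaluation_functional hψpos hc hTadd hTsmul
        (fun h hh => (hT h hh).1) (fun h hh => (hT h hh).2.1) hw
      exact ⟨Φ, fun _ => h⟩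
    · exact ⟨0, fun h => absurd h hw⟩
  choose Φ hΦ using hΦ
  intro a ha
  rw [memFibLp_one_iff] at ha
  have hnorm : ∀ (s : r ⁻¹' {z}) (w : N'), ‖a s * F s w‖ = ‖a s‖ * ψ s * ‖T (fibExtend r ψ z (e s)) w‖ ^ 2 :=
    fun s w => by
      rw [hFe, norm_mul, norm_mul, norm_pow, Complex.norm_real,
        Real.norm_of_nonneg (hψpos s).le, mul_assoc]
  have haψ : ∀ s : r ⁻¹' {z}, 0 ≤ ‖a s‖ * ψ s :=
    fun s => mul_nonneg (norm_nonneg _) (hψpos s).le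
  have hpt : ∀ w, r w ∈ M → Summable fun s : r ⁻¹' {z} => ‖a s * F s w‖ := fun w hw => by
    refine Summable.of_nonneg_of_le (fun _ => norm_nonneg _) (fun s => ?_)
      (ha.mul_right (c ^ 2 / ψ w))
    rw [hnorm]
    refine mul_le_mul_of_nonneg_left ?_ (haψ s)
    rw [le_div_iff₀ (hψpos w)]
    exact (norm_sq_mul_le_tsum hψpos (hsum s _ hw).1).trans (hsum s _ hw).2
  have hfib : ∀ x ∈ M, (Summable fun y : r ⁻¹' {x} => ‖Tt a y‖ * ψ y) ∧
      ∑' y : r ⁻¹' {x}, ‖Tt a y‖ * ψ y ≤ c ^ 2 * fibLpNorm r ψ 1 z a := fun x hx => by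
    simp only [hTt]
    rw [fibLpNorm_one, ← tsum_mul_left]
    refine summable_norm_tsum_mul_and_tsum_le (G := fun (s : r ⁻¹' {z}) (y : r ⁻¹' {x}) => a s * F s y)
      (fun y => (hψpos y).le) (ha.mul_left _) (fun s => ?_) (fun s => ?_) (fun y => ?_)
    · simp only [hnorm, mul_assoc (‖a s‖ * ψ s)]
      exact (hsum s x hx).1.mul_left _
    · simp only [hnorm, mul_assoc (‖a s‖ * ψ s)]
      rw [tsum_mul_left, mul_comm]
      exact mul_le_mul_of_nonneg_right (hsum s x hx).2 (haψ s)
    · exact hpt y (by rw [show r y = x from y.2]; exact hx)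
  have hle : ∀ x : M, fibLpNorm r ψ 1 ↑x (Tt a) ≤ c ^ 2 * fibLpNorm r ψ 1 z a := fun x => by
    rw [fibLpNorm_one (x := (x : N))]
    exact (hfib x x.2).2
  refine ⟨⟨?_, fun x hx => memFibLp_one_iff.2 (hfib x hx).1,
    ⟨c ^ 2 * fibLpNorm r ψ 1 z a, ?_⟩⟩, ciSup_le hle, ?_⟩
  · intro w hw
    refine MDifferentiableAt.mdifferentiableWithinAt ?_
    have hwχ : w ∈ (chartAt (Fin n → ℂ) w).source := mem_chart_source _ w
    set χ := chartAt (Fin n → ℂ) w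
    have hχc : ContinuousAt χ.symm (χ w) := χ.continuousAt_symm (χ.map_source hwχ)
    have hχw : χ.symm (χ w) = w := χ.left_inv hwχ
    have hnear : ∀ᶠ u in 𝓝 (χ w), r (χ.symm u) ∈ M :=
      hχc.eventually (by rw [hχw]; exact hM'o.mem_nhds hw)
    have hK : ∀ᶠ u in 𝓝 (χ w), ‖Φ (χ.symm u)‖ ≤ c * (√(ψ w / 2))⁻¹ := by
      have hψn : ∀ᶠ u in 𝓝 (χ w), ψ w / 2 < ψ (χ.symm u) :=
        hχc.eventually (by
          rw [hχw]
          exact hψc.continuousAt.eventually_const_lt (half_lt_self (hψpos w)))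
      filter_upwards [hnear, hψn] with u hu hu'
      refine (hΦ _ hu).2.trans (mul_le_mul_of_nonneg_left ?_ hc)
      have := half_pos (hψpos w)
      gcongr
    have hdT : ∀ ξ : lp (fun _ : r ⁻¹' {z} => ℂ) 2,
        DifferentiableAt ℂ (fun u => T (fibExtend r ψ z ξ) (χ.symm u)) (χ w) := fun ξ => by
      exact mdifferentiableAt_complex_iff.1 (((hTm ξ).1.1 w hw).mdifferentiableAt (hM'o.mem_nhds hw))
    obtain ⟨C, hC⟩ := exists_lipschitz_at_of_pointwise_differentiableAt
      (Φ := fun u => Φ (χ.symm u)) (fun ξ => (hdT ξ).congr_of_eventuallyEq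
        (hnear.mono fun u hu => (hΦ _ hu).1 ξ)) hK
    have hdiff : DifferentiableAt ℂ (fun u => ∑' s : r ⁻¹' {z}, a ↑s * F s (χ.symm u)) (χ w) := by
      set K := c * (√(ψ w / 2))⁻¹
      have hK0 : 0 ≤ K := by positivity
      refine differentiableAt_tsum_of_summable_lipschitz_at
        (B := fun s : r ⁻¹' {z} => ‖a s‖ * ψ s * (|C| * (2 * K)))
        (fun s => mul_nonneg (haψ s) (by positivity)) (ha.mul_right _) (fun s => ?_) ?_ ?_
      · simp only [hFe]
        exact (((hdT (e s)).pow 2).const_mul _).const_mul _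
      · exact (hpt _ hnear.self_of_nhds).of_norm
      · filter_upwards [hnear, hK, hC] with u hu hKu hCu s
        have hp := hnear.self_of_nhds
        have h1 : ‖Φ (χ.symm u) (e s) - Φ (χ.symm (χ w)) (e s)‖ ≤ |C| * ‖u - χ w‖ := by
          have := ((Φ (χ.symm u) - Φ (χ.symm (χ w))).le_of_opNorm_le hCu (e s))
          rw [hen, mul_one] at this
          exact this.trans (mul_le_mul_of_nonneg_right (le_abs_self C) (norm_nonneg _))
        have h2 : ‖Φ (χ.symm u) (e s) + Φ (χ.symm (χ w)) (e s)‖ ≤ 2 * K := by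
          have h3 := (Φ (χ.symm u)).le_of_opNorm_le hKu (e s)
          have h4 := (Φ (χ.symm (χ w))).le_of_opNorm_le hK.self_of_nhds (e s)
          rw [hen, mul_one] at h3 h4
          exact (norm_add_le _ _).trans (by linarith)
        have h5 : a s * F s (χ.symm u) - a s * F s (χ.symm (χ w)) =
            a s * ψ s * ((Φ (χ.symm u) (e s) - Φ (χ.symm (χ w)) (e s)) *
              (Φ (χ.symm u) (e s) + Φ (χ.symm (χ w)) (e s))) := by
          rw [hFe, hFe, (hΦ _ hu).1, (hΦ _ hp).1]
          ring
        rw [h5, norm_mul, norm_mul, norm_mul, Complex.norm_real,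
          Real.norm_of_nonneg (hψpos s).le, mul_assoc (‖a s‖ * ψ s)]
        refine mul_le_mul_of_nonneg_left ?_ (haψ s)
        calc _ ≤ |C| * ‖u - χ w‖ * (2 * K) := by gcongr
          _ = |C| * (2 * K) * ‖u - χ w‖ := by ring
    rw [mdifferentiableAt_complex_iff]
    simpa only [hTt] using hdiff
  · rintro _ ⟨x, rfl⟩
    exact hle x
  · intro x hx
    have hval : ∀ s : r ⁻¹' {z}, F s x =
        (ψ s : ℂ) * (if x = s then ((ψ s ^ (-(1 / 2) : ℝ) : ℝ) : ℂ) else 0) ^ 2 := fun s => by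
      rw [hFe, (hTm (e s)).2.2 x hx, fibExtend_single]
    rw [hTt, tsum_eq_single (⟨x, hx⟩ : r ⁻¹' {z})]
    · rw [hval, if_pos rfl]
      have h := congrArg (fun t : ℝ => (t : ℂ)) (rpow_neg_half_sq_mul (hψpos x))
      push_cast at h ⊢
      rw [mul_comm (ψ x : ℂ), h, mul_one]
    · intro s hs
      have : x ≠ s := fun h => hs (Subtype.ext h.symm)
      rw [hval, if_neg this]
      simp

end
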